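/- arXiv:1212.2851 — 3 statements merged into one kernel-verified Lean document; each statement's English description precedes it below -/
import Mathlib

section
/- A nonsingular cubic surface in ℙ³(ℂ) contains at most five twistor lines; that is, for a nonzero homogeneous cubic f in z₁,z₂,z₃,z₄ whose zero locus is nonsingular, the set of 2-dimensional ℂ-subspaces W of ℂ⁴ with j(W) = W on which f vanishes identically has at most 5 elements. -/
noncomputable section

open MvPolynomial

/-- The standard twistor structure `j : ℂ⁴ → ℂ⁴`,
`j(z₁,z₂,z₃,z₄) = (−z̄₂, z̄₁, −z̄₄, z̄₃)`. -/
def J : (Fin 4 → ℂ) → (Fin 4 → ℂ) :=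
  fun z => ![-(starRingEnd ℂ) (z 1), (starRingEnd ℂ) (z 0),
             -(starRingEnd ℂ) (z 3), (starRingEnd ℂ) (z 2)]

/-- A line in `ℙ³(ℂ)`: a 2-dimensional `ℂ`-subspace of `ℂ⁴`. -/
def IsLine (W : Submodule ℂ (Fin 4 → ℂ)) : Prop := Module.finrank ℂ W = 2

/-- A twistor line: a line whose underlying subspace satisfies `j(W) = W`. -/
def IsTwistorLine (W : Submodule ℂ (Fin 4 → ℂ)) : Prop :=
  IsLine W ∧ J '' (W : Set (Fin 4 → ℂ)) = (W : Set (Fin 4 → ℂ))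

/-- A polynomial vanishes identically on a subspace. -/
def VanishesOn (f : MvPolynomial (Fin 4) ℂ) (W : Submodule ℂ (Fin 4 → ℂ)) : Prop :=
  ∀ z ∈ W, eval z f = 0

/-- The surface `{f = 0}` is nonsingular: no nonzero point of `ℂ⁴` is a common zero of
`f` and all its partial derivatives. -/
def Nonsingular (f : MvPolynomial (Fin 4) ℂ) : Prop :=
  ∀ z : Fin 4 → ℂ, z ≠ 0 → eval z f = 0 → ∃ i, eval z (pderiv i f) ≠ 0

theorem exists_root_quadratic {a : ℂ} (ha : a ≠ 0) (b c : ℂ) :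
    ∃ y : ℂ, a * y ^ 2 + b * y + c = 0 := by
  obtain ⟨y, hy⟩ := exists_quadratic_eq_zero ha (IsAlgClosed.exists_eq_mul_self (discrim a b c))
  exact ⟨y, by linear_combination hy⟩

/-- A cubic polynomial has two distinct roots or a double root. -/
theorem exists_roots_cubic {a : ℂ} (ha : a ≠ 0) (b c d : ℂ) : ∃ y₀ y₁ : ℂ,
    a * y₀ ^ 3 + b * y₀ ^ 2 + c * y₀ + d = 0 ∧ a * y₁ ^ 3 + b * y₁ ^ 2 + c * y₁ + d = 0 ∧
      (y₀ = y₁ → 3 * a * y₀ ^ 2 + 2 * b * y₀ + c = 0) := by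
  obtain ⟨y₀, h0⟩ := IsAlgClosed.exists_root (Cubic.toPoly ⟨a, b, c, d⟩)
    (by rw [Cubic.degree_of_a_ne_zero (by exact ha)]; decide)
  simp only [Cubic.toPoly, Polynomial.IsRoot.def, Polynomial.eval_add, Polynomial.eval_mul,
    Polynomial.eval_C, Polynomial.eval_pow, Polynomial.eval_X] at h0
  obtain ⟨y₁, h1⟩ := exists_root_quadratic ha (a * y₀ + b) (a * y₀ ^ 2 + b * y₀ + c)
  refine ⟨y₀, y₁, h0, by linear_combination h0 + (y₁ - y₀) * h1, ?_⟩
  rintro rfl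
  linear_combination h1

section CubicForm

variable {V : Type*} [AddCommGroup V] [Module ℂ V]

/-- A symmetric trilinear form whose associated cubic `z ↦ T z z z` has no singular zero. -/
structure IsSmoothForm (T : V →ₗ[ℂ] V →ₗ[ℂ] V →ₗ[ℂ] ℂ) : Prop where
  symm_left : ∀ x y, T x y = T y x
  symm_right : ∀ x y z, T x y z = T x z y
  nondeg : ∀ z, z ≠ 0 → T z z ≠ 0

variable {T : V →ₗ[ℂ] V →ₗ[ℂ] V →ₗ[ℂ] ℂ}

theorem IsSmoothForm.apply_self_add (h : IsSmoothForm T) (x y : V) :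
    T (x + y) (x + y) (x + y) = T x x x + 3 * T x x y + 3 * T x y y + T y y y := by
  simp only [map_add, LinearMap.add_apply]
  rw [h.symm_left y x, h.symm_right x y x, h.symm_right y y x, h.symm_left y x]
  ring

/-- A cubic form vanishing on a subspace is totally polarized to zero there. -/
theorem IsSmoothForm.polar_eq_zero (h : IsSmoothForm T) {W : Submodule ℂ V}
    (hW : ∀ z ∈ W, T z z z = 0) {x y : V} (hx : x ∈ W) (hy : y ∈ W) : T x x y = 0 := by
  have h1 := h.apply_self_add x y
  have h2 := h.apply_self_add x (-y)
  rw [hW _ (W.add_mem hx hy), hW x hx, hW y hy] at h1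
  rw [hW _ (W.add_mem hx (W.neg_mem hy)), hW x hx, hW _ (W.neg_mem hy)] at h2
  simp only [map_neg, LinearMap.neg_apply] at h2
  linear_combination (h2 - h1) / 6

/-- Transversality at the line joining `s` and `t`: the two bihomogeneous components of the cubic
have independent differentials there. -/
theorem IsSmoothForm.jacobian_ne (h : IsSmoothForm T) {s u t v : V}
    (hst : ∀ l m : ℂ, l • s + m • t = 0 → l = 0 ∧ m = 0)
    (hspan : ∀ φ : V →ₗ[ℂ] ℂ, φ s = 0 → φ u = 0 → φ t = 0 → φ v = 0 → φ = 0)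
    (hsss : T s s s = 0) (hssu : T s s u = 0) (httt : T t t t = 0) (httv : T t t v = 0)
    (hsst : T s s t = 0) (hstt : T s t t = 0) :
    (2 * T s t u) * (2 * T s t v) ≠ T t t u * T s s v := by
  intro hdet
  obtain ⟨l, m, hlm, h1, h2⟩ : ∃ l m : ℂ, ¬ (l = 0 ∧ m = 0) ∧
      l * (2 * T s t u) + m * T t t u = 0 ∧ l * T s s v + m * (2 * T s t v) = 0 := by
    by_cases hab : T t t u = 0 ∧ T s t u = 0
    · by_cases hcd : T s t v = 0 ∧ T s s v = 0
      · exact ⟨1, 0, by simp, by simp [hab], by simp [hcd]⟩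
      · refine ⟨2 * T s t v, -T s s v, by simpa using hcd, by simp [hab], by ring⟩
    · refine ⟨T t t u, -(2 * T s t u), by simpa using hab, by ring, ?_⟩
      linear_combination -hdet
  refine h.nondeg (l • s + m • t) (fun h0 => hlm (hst l m h0)) (hspan _ ?_ ?_ ?_ ?_) <;>
    simp only [map_add, map_smul, LinearMap.add_apply, LinearMap.smul_apply, smul_eq_mul,
      h.symm_left t s]
  · rw [hsss, h.symm_right s t s, hsst, h.symm_right t t s, h.symm_left t s, hstt]; ring
  · linear_combination l ^ 2 * hssu + m * h1
  · rw [hsst, hstt, httt]; ring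
  · linear_combination m ^ 2 * httv + l * h2

/-- The cubic contains the four sides `PQ`, `P'Q'`, `PP'`, `QQ'` of a tetrahedron `PQP'Q'`. -/
structure IsSkewQuadrilateral (T : V →ₗ[ℂ] V →ₗ[ℂ] V →ₗ[ℂ] ℂ) (P Q P' Q' : V) : Prop
    extends IsSmoothForm T where
  indep : ∀ a b c d : ℂ, a • P + b • Q + c • P' + d • Q' = 0 → a = 0 ∧ b = 0 ∧ c = 0 ∧ d = 0
  span : ∀ φ : V →ₗ[ℂ] ℂ, φ P = 0 → φ Q = 0 → φ P' = 0 → φ Q' = 0 → φ = 0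
  PPP : T P P P = 0
  PPQ : T P P Q = 0
  PQQ : T P Q Q = 0
  QQQ : T Q Q Q = 0
  PPP' : T P' P' P' = 0
  PPQ' : T P' P' Q' = 0
  PQQ' : T P' Q' Q' = 0
  QQQ' : T Q' Q' Q' = 0
  side_PPP : T P P P' = 0
  side_PPP' : T P P' P' = 0
  side_QQQ : T Q Q Q' = 0
  side_QQQ' : T Q Q' Q' = 0

namespace IsSkewQuadrilateral

variable {P Q P' Q' : V} (h : IsSkewQuadrilateral T P Q P' Q')

include h

theorem apply_left (x₁ x₂ y₁ y₂ z₁ z₂ : ℂ) :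
    T (x₁ • P + x₂ • Q) (y₁ • P + y₂ • Q) (z₁ • P + z₂ • Q) = 0 := by
  simp only [map_add, map_smul, LinearMap.add_apply, LinearMap.smul_apply, smul_eq_mul]
  rw [h.symm_left Q P, h.symm_right P Q P, h.symm_right Q Q P, h.symm_left Q P, h.PPP, h.PPQ,
    h.PQQ, h.QQQ]
  ring

theorem swap : IsSkewQuadrilateral T P' Q' P Q where
  __ := h.toIsSmoothForm
  indep a b c d h0 := by
    obtain ⟨h1, h2, h3, h4⟩ := h.indep c d a b (by rw [← h0]; abel)
    exact ⟨h3, h4, h1, h2⟩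
  span φ h1 h2 h3 h4 := h.span φ h3 h4 h1 h2
  PPP := h.PPP'
  PPQ := h.PPQ'
  PQQ := h.PQQ'
  QQQ := h.QQQ'
  PPP' := h.PPP
  PPQ' := h.PPQ
  PQQ' := h.PQQ
  QQQ' := h.QQQ
  side_PPP := by rw [h.symm_right, h.symm_left, h.side_PPP']
  side_PPP' := by rw [h.symm_left, h.symm_right, h.side_PPP]
  side_QQQ := by rw [h.symm_right, h.symm_left, h.side_QQQ']
  side_QQQ' := by rw [h.symm_left, h.symm_right, h.side_QQQ]

theorem apply_sst (s₁ s₂ t₁ t₂ : ℂ) :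
    T (s₁ • P + s₂ • Q) (s₁ • P + s₂ • Q) (t₁ • P' + t₂ • Q') =
      s₁ ^ 2 * t₂ * T P P Q' + 2 * s₁ * s₂ * t₁ * T P Q P' + 2 * s₁ * s₂ * t₂ * T P Q Q' +
        s₂ ^ 2 * t₁ * T Q Q P' := by
  simp only [map_add, map_smul, LinearMap.add_apply, LinearMap.smul_apply, smul_eq_mul]
  rw [h.symm_left Q P, h.side_PPP, h.side_QQQ]
  ring

theorem apply_stt (s₁ s₂ t₁ t₂ : ℂ) :
    T (s₁ • P + s₂ • Q) (t₁ • P' + t₂ • Q') (t₁ • P' + t₂ • Q') =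
      t₁ ^ 2 * s₂ * T Q P' P' + 2 * t₁ * t₂ * s₁ * T P P' Q' + 2 * t₁ * t₂ * s₂ * T Q P' Q' +
        t₂ ^ 2 * s₁ * T P Q' Q' := by
  simp only [map_add, map_smul, LinearMap.add_apply, LinearMap.smul_apply, smul_eq_mul]
  rw [h.symm_right P Q' P', h.symm_right Q Q' P', h.side_PPP', h.side_QQQ']
  ring

/-- For given `s`, at most one `t` up to scale satisfies `T s s t = 0`. -/
theorem tangent_unique {s₁ s₂ t₁ t₂ r₁ r₂ : ℂ} (hs : ¬ (s₁ = 0 ∧ s₂ = 0))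
    (ht : T (s₁ • P + s₂ • Q) (s₁ • P + s₂ • Q) (t₁ • P' + t₂ • Q') = 0)
    (hr : T (s₁ • P + s₂ • Q) (s₁ • P + s₂ • Q) (r₁ • P' + r₂ • Q') = 0) :
    t₁ * r₂ = t₂ * r₁ := by
  by_contra hne
  have hs0 : s₁ • P + s₂ • Q ≠ 0 := by
    intro h0
    obtain ⟨h1, h2, -⟩ := h.indep s₁ s₂ 0 0 (by simpa using h0)
    exact hs ⟨h1, h2⟩
  have hne' := sub_ne_zero.2 hne
  refine h.nondeg _ hs0 (h.span _ ?_ ?_ ?_ ?_)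
  · simpa using h.apply_left s₁ s₂ s₁ s₂ 1 0
  · simpa using h.apply_left s₁ s₂ s₁ s₂ 0 1
  all_goals
    rw [map_add, map_smul, map_smul, smul_eq_mul, smul_eq_mul] at ht hr
    apply mul_left_cancel₀ hne'
  · linear_combination r₂ * ht - t₂ * hr
  · linear_combination t₁ * hr - r₁ * ht

theorem PPQ'_ne : T P P Q' ≠ 0 := by
  intro h0
  have := h.tangent_unique (s₁ := 1) (s₂ := 0) (t₁ := 1) (t₂ := 0) (r₁ := 0) (r₂ := 1)
    (by simp) (by simpa using h.side_PPP) (by simpa using h0)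
  simp at this

theorem QQP'_ne : T Q Q P' ≠ 0 := by
  intro h0
  have := h.tangent_unique (s₁ := 0) (s₂ := 1) (t₁ := 1) (t₂ := 0) (r₁ := 0) (r₂ := 1)
    (by simp) (by simpa using h0) (by simpa using h.side_QQQ)
  simp at this

/-- The points of `PQ`, in the coordinate `σ`, through which there passes a line on the cubic
meeting `P'Q'` satisfy a cubic equation, once the side through `P` is discarded. -/
theorem transversal_equation {σ t₁ t₂ : ℂ} (hσ : σ ≠ 0) (ht : ¬ (t₁ = 0 ∧ t₂ = 0))
    (h1 : T (P + σ • Q) (P + σ • Q) (t₁ • P' + t₂ • Q') = 0)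
    (h2 : T (P + σ • Q) (t₁ • P' + t₂ • Q') (t₁ • P' + t₂ • Q') = 0) :
    T Q P' P' * (T P P Q' + 2 * T P Q Q' * σ) ^ 2 -
      2 * (T P P' Q' + T Q P' Q' * σ) * (2 * T P Q P' + T Q Q P' * σ) *
        (T P P Q' + 2 * T P Q Q' * σ) +
      T P Q' Q' * σ * (2 * T P Q P' + T Q Q P' * σ) ^ 2 = 0 := by
  have e1 := h.apply_sst 1 σ t₁ t₂
  have e2 := h.apply_stt 1 σ t₁ t₂
  rw [one_smul] at e1 e2
  rw [h1] at e1
  rw [h2] at e2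
  generalize T P P Q' = a at *
  generalize T P Q P' = b at *
  generalize T P Q Q' = c at *
  generalize T Q Q P' = d at *
  generalize T Q P' P' = a' at *
  generalize T P P' Q' = b' at *
  generalize T Q P' Q' = c' at *
  generalize T P Q' Q' = d' at *
  set g := a + 2 * c * σ with hg
  set k := 2 * b + d * σ with hk
  have e3 : t₂ * g = -(t₁ * σ * k) := by rw [hg, hk]; linear_combination -e1
  apply mul_left_cancel₀ hσ
  by_cases h0 : t₁ = 0
  · have h0' : t₂ ≠ 0 := fun h' => ht ⟨h0, h'⟩
    subst h0
    have hg0 : g = 0 := by simpa [h0'] using e3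
    have hd0 : d' = 0 := by simpa [h0'] using e2
    rw [hg0, hd0]; ring
  · apply mul_left_cancel₀ (pow_ne_zero 2 h0)
    linear_combination (-g ^ 2) * e2 -
      (2 * t₁ * (b' + c' * σ) * g + d' * (t₂ * g - t₁ * σ * k)) * e3

theorem not_four_transversals {σ t₁ t₂ : Fin 4 → ℂ} (hinj : Function.Injective σ)
    (hσ : ∀ i, σ i ≠ 0) (ht : ∀ i, ¬ (t₁ i = 0 ∧ t₂ i = 0))
    (h1 : ∀ i, T (P + σ i • Q) (P + σ i • Q) (t₁ i • P' + t₂ i • Q') = 0)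
    (h2 : ∀ i, T (P + σ i • Q) (t₁ i • P' + t₂ i • Q') (t₁ i • P' + t₂ i • Q') = 0) :
    False := by
  have key := fun i => h.transversal_equation (hσ i) (ht i) (h1 i) (h2 i)
  have hne := h.PPQ'_ne
  have hjac := h.jacobian_ne (s := P) (u := Q) (t := P') (v := Q')
    (fun l m h0 => by
      obtain ⟨h1, -, h2, -⟩ := h.indep l 0 m 0 (by simpa using h0)
      exact ⟨h1, h2⟩)
    h.span h.PPP h.PPQ h.PPP' h.PPQ' h.side_PPP h.side_PPP'
  rw [h.symm_right P P' Q, h.symm_right P' P' Q, h.symm_left P' Q] at hjac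
  generalize T P P Q' = a at *
  generalize T P Q P' = b at *
  generalize T P Q Q' = c at *
  generalize T Q Q P' = d at *
  generalize T Q P' P' = a' at *
  generalize T P P' Q' = b' at *
  generalize T Q P' Q' = c' at *
  generalize T P Q' Q' = d' at *
  have hr : a * (a' * a - 4 * b * b') = 0 := by
    let p : Polynomial ℂ :=
      .C a' * (.C a + 2 * .C c * .X) ^ 2 -
        2 * (.C b' + .C c' * .X) * (2 * .C b + .C d * .X) * (.C a + 2 * .C c * .X) +
        .C d' * .X * (2 * .C b + .C d * .X) ^ 2
    have hp : p = 0 := by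
      apply Polynomial.eq_zero_of_natDegree_lt_card_of_eval_eq_zero p hinj
      · intro i
        simpa [p] using key i
      · rw [Fintype.card_fin]
        have : p.natDegree ≤ 3 := by
          simp only [p]
          compute_degree
        omega
    have := congrArg (Polynomial.eval 0) hp
    simp [p] at this
    linear_combination this
  rcases mul_eq_zero.1 hr with h0 | h0
  · exact hne h0
  · apply hjac; linear_combination -h0

/-- A line on the cubic which is skew to `PQ` and `P'Q'` meets at least two lines on the cubic
that are transversal to `PQ` and `P'Q'`. -/
theorem exists_two_transversals {m n m' n' : ℂ} (hn : n ≠ 0) (hn' : n' ≠ 0)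
    {W : Submodule ℂ V} (hW : ∀ z ∈ W, T z z z = 0)
    (hw : P + m • Q + n • Q' ∈ W) (hw' : -n' • Q + (P' + m' • Q') ∈ W) :
    ∃ y : Fin 2 → ℂ, y 0 ≠ y 1 ∧ ∀ i,
      T (P + (m - n' * y i) • Q) (P + (m - n' * y i) • Q) (y i • P' + (n + m' * y i) • Q') = 0 ∧
      T (P + (m - n' * y i) • Q) (y i • P' + (n + m' * y i) • Q')
        (y i • P' + (n + m' * y i) • Q') = 0 := by
  have hd := h.QQP'_ne
  have hmem (y : ℂ) : (P + (m - n' * y) • Q) + (y • P' + (n + m' * y) • Q') ∈ W := by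
    convert W.add_mem hw (W.smul_mem y hw') using 1
    module
  have hvan (y : ℂ) : T (P + (m - n' * y) • Q) (P + (m - n' * y) • Q)
        (y • P' + (n + m' * y) • Q') = 0 →
      T (P + (m - n' * y) • Q) (y • P' + (n + m' * y) • Q')
        (y • P' + (n + m' * y) • Q') = 0 := by
    intro h0
    have h1 := hW _ (hmem y)
    rw [h.apply_self_add, h0] at h1
    have h2 := h.apply_left 1 (m - n' * y) 1 (m - n' * y) 1 (m - n' * y)
    have h3 := h.swap.apply_left y (n + m' * y) y (n + m' * y) y (n + m' * y)
    rw [one_smul] at h2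
    rw [h2, h3] at h1
    linear_combination h1 / 3
  have hC (y : ℂ) := h.apply_sst 1 (m - n' * y) y (n + m' * y)
  simp only [one_smul] at hC
  obtain ⟨y₀, y₁, h0, h1, hdbl⟩ : ∃ y₀ y₁ : ℂ,
      T (P + (m - n' * y₀) • Q) (P + (m - n' * y₀) • Q) (y₀ • P' + (n + m' * y₀) • Q') = 0 ∧
      T (P + (m - n' * y₁) • Q) (P + (m - n' * y₁) • Q) (y₁ • P' + (n + m' * y₁) • Q') = 0 ∧
      (y₀ = y₁ → m' * T P P Q' + 2 * (m - 2 * n' * y₀) * T P Q P' +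
        2 * (m * m' - n' * n - 2 * n' * m' * y₀) * T P Q Q' +
        ((m - n' * y₀) ^ 2 - 2 * n' * y₀ * (m - n' * y₀)) * T Q Q P' = 0) := by
    simp only [hC]
    generalize T P P Q' = a at *
    generalize T P Q P' = b at *
    generalize T P Q Q' = c at *
    generalize T Q Q P' = d at *
    have hlead : n' ^ 2 * d ≠ 0 := mul_ne_zero (pow_ne_zero 2 hn') hd
    obtain ⟨y₀, y₁, h0, h1, h2⟩ := exists_roots_cubic hlead
      (-2 * n' * b - 2 * n' * m' * c - 2 * m * n' * d)
      (m' * a + 2 * m * b + 2 * (m * m' - n' * n) * c + m ^ 2 * d) (n * a + 2 * m * n * c)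
    exact ⟨y₀, y₁, by linear_combination h0, by linear_combination h1,
      fun hy => by linear_combination h2 hy⟩
  refine ⟨![y₀, y₁], ?_, ?_⟩
  · rintro (rfl : y₀ = y₁)
    have hdbl := hdbl rfl
    set s := P + (m - n' * y₀) • Q with hs
    set t := y₀ • P' + (n + m' * y₀) • Q' with ht
    set u := (-n') • Q with hu
    set v := P' + m' • Q' with hv
    have hleft := h.apply_left 1 (m - n' * y₀) 1 (m - n' * y₀)
    have hright := h.swap.apply_left y₀ (n + m' * y₀) y₀ (n + m' * y₀)
    simp only [one_smul, ← hs, ← ht] at hleft hright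
    have hssu : T s s u = 0 := by simpa [hu] using hleft 0 (-n')
    have hsss : T s s s = 0 := by
      simpa only [one_smul, ← hs] using hleft 1 (m - n' * y₀)
    have httt : T t t t = 0 := hright y₀ (n + m' * y₀)
    have httv : T t t v = 0 := by simpa [hv] using hright 1 m'
    have hA : 2 * T s t u + T s s v = 0 := by
      simp only [hs, ht, hu, hv, map_add, map_smul, LinearMap.add_apply, LinearMap.smul_apply,
        smul_eq_mul]
      rw [h.symm_left Q P, h.symm_right P P' Q, h.symm_right P Q' Q, h.symm_right Q P' Q,
        h.symm_right Q Q' Q, h.side_PPP, h.side_QQQ]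
      linear_combination hdbl
    have hB : 2 * T s t v + T t t u = 0 := by
      have h3 := h.polar_eq_zero hW (hmem y₀) (y := u + v)
        (by simpa only [hu, hv] using hw')
      simp only [← hs, ← ht, map_add, LinearMap.add_apply] at h3
      rw [h.symm_left t s, hssu, httv] at h3
      linear_combination h3 - hA
    refine h.jacobian_ne (s := s) (u := u) (t := t) (v := v) ?_ ?_ hsss hssu httt httv h0
      (hvan _ h0) (by linear_combination 2 * T s t v * hA - T s s v * hB)
    · intro l k h0
      obtain ⟨h1, -, h2, h3⟩ := h.indep l (l * (m - n' * y₀)) (k * y₀) (k * (n + m' * y₀))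
        (by rw [← h0]; module)
      refine ⟨h1, ?_⟩
      apply mul_left_cancel₀ hn
      linear_combination h3 - m' * h2
    · intro φ h1 h2 h3 h4
      simp only [hs, ht, hu, hv, map_add, map_smul, smul_eq_mul] at h1 h2 h3 h4
      have hQ : φ Q = 0 := by simpa [hn'] using h2
      have hQ' : φ Q' = 0 := by
        apply mul_left_cancel₀ hn
        linear_combination h3 - y₀ * h4
      refine h.span φ ?_ hQ ?_ hQ'
      · simpa [hQ] using h1
      · simpa [hQ'] using h4
  · intro i
    fin_cases i
    · exact ⟨h0, hvan _ h0⟩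
    · exact ⟨h1, hvan _ h1⟩

end IsSkewQuadrilateral

end CubicForm

theorem pderiv_pderiv_comm {σ R : Type*} [CommRing R] (i j : σ) (p : MvPolynomial σ R) :
    pderiv i (pderiv j p) = pderiv j (pderiv i p) := by
  classical
  have : ⁅pderiv (R := R) i, pderiv (R := R) j⁆ = 0 := by
    ext k
    simp [Derivation.commutator_apply, pderiv_X, Pi.single_apply, apply_ite (pderiv _)]
  have h := congrArg (fun D => D p) this
  simpa [Derivation.commutator_apply, sub_eq_zero] using h

theorem sum_mul_eval_pderiv {f : MvPolynomial (Fin 4) ℂ} {n : ℕ} (h : f.IsHomogeneous n)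
    (z : Fin 4 → ℂ) : ∑ i, z i * eval z (pderiv i f) = n * eval z f := by
  simpa [map_sum] using congrArg (eval z) h.sum_X_mul_pderiv

/-- The polarization of a homogeneous cubic. -/
def cubicPolar (f : MvPolynomial (Fin 4) ℂ) :
    (Fin 4 → ℂ) →ₗ[ℂ] (Fin 4 → ℂ) →ₗ[ℂ] (Fin 4 → ℂ) →ₗ[ℂ] ℂ :=
  ∑ i, ∑ j, ∑ k, (LinearMap.proj i : (Fin 4 → ℂ) →ₗ[ℂ] ℂ).smulRight
    ((LinearMap.proj j : (Fin 4 → ℂ) →ₗ[ℂ] ℂ).smulRight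
      ((eval 0 (pderiv i (pderiv j (pderiv k f))) / 6) • (LinearMap.proj k)))

theorem cubicPolar_apply (f : MvPolynomial (Fin 4) ℂ) (x y z : Fin 4 → ℂ) :
    cubicPolar f x y z =
      ∑ i, ∑ j, ∑ k, x i * y j * z k * (eval 0 (pderiv i (pderiv j (pderiv k f))) / 6) := by
  simp only [cubicPolar, LinearMap.sum_apply, LinearMap.smulRight_apply, LinearMap.smul_apply,
    LinearMap.proj_apply, smul_eq_mul]
  congr! 3
  ring

theorem cubicPolar_self_left {f : MvPolynomial (Fin 4) ℂ} (h : f.IsHomogeneous 3)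
    (z w : Fin 4 → ℂ) : cubicPolar f z z w = (∑ k, w k * eval z (pderiv k f)) / 3 := by
  have h1 (k) := sum_mul_eval_pderiv (h.pderiv (i := k)) z
  have h2 (k j) := sum_mul_eval_pderiv ((h.pderiv (i := k)).pderiv (i := j)) z
  have h3 (k j i) : eval z (pderiv i (pderiv j (pderiv k f))) =
      eval 0 (pderiv i (pderiv j (pderiv k f))) := by
    have := ((h.pderiv (i := k)).pderiv (i := j)).pderiv (i := i)
    rw [← totalDegree_zero_iff_isHomogeneous, totalDegree_eq_zero_iff_eq_C] at this
    rw [this]; simp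
  have h4 (k) : eval z (pderiv k f) = (∑ j, z j * ∑ i, z i *
      eval 0 (pderiv i (pderiv j (pderiv k f)))) / 2 := by
    have h5 (j) : eval z (pderiv j (pderiv k f)) =
        ∑ i, z i * eval 0 (pderiv i (pderiv j (pderiv k f))) := by
      simpa [h3] using (h2 k j).symm
    have := h1 k
    simp only [h5] at this
    rw [this]
    norm_num
  rw [cubicPolar_apply, Finset.sum_comm_cycle, Finset.sum_div]
  refine Finset.sum_congr rfl fun k _ => ?_
  rw [Finset.sum_comm, h4]
  simp only [Finset.mul_sum, Finset.sum_div]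
  refine Finset.sum_congr rfl fun j _ => Finset.sum_congr rfl fun i _ => ?_
  ring

theorem cubicPolar_self {f : MvPolynomial (Fin 4) ℂ} (h : f.IsHomogeneous 3) (z : Fin 4 → ℂ) :
    cubicPolar f z z z = eval z f := by
  rw [cubicPolar_self_left h, sum_mul_eval_pderiv h]
  norm_num

theorem isSmoothForm_cubicPolar {f : MvPolynomial (Fin 4) ℂ} (h : f.IsHomogeneous 3)
    (hns : Nonsingular f) : IsSmoothForm (cubicPolar f) where
  symm_left x y := by
    refine LinearMap.ext fun z => ?_
    rw [cubicPolar_apply, cubicPolar_apply, Finset.sum_comm]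
    refine Finset.sum_congr rfl fun i _ => Finset.sum_congr rfl fun j _ =>
      Finset.sum_congr rfl fun k _ => ?_
    rw [pderiv_pderiv_comm i j]; ring
  symm_right x y z := by
    rw [cubicPolar_apply, cubicPolar_apply]
    refine Finset.sum_congr rfl fun i _ => ?_
    rw [Finset.sum_comm]
    refine Finset.sum_congr rfl fun j _ => Finset.sum_congr rfl fun k _ => ?_
    rw [pderiv_pderiv_comm j k]; ring
  nondeg z hz h0 := by
    obtain ⟨i, hi⟩ := hns z hz (by rw [← cubicPolar_self h, h0, LinearMap.zero_apply])
    apply hi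
    have := cubicPolar_self_left h z (Pi.single i 1)
    simpa [h0, Pi.single_apply] using this.symm

theorem J_add (x y : Fin 4 → ℂ) : J (x + y) = J x + J y := by
  ext i
  fin_cases i <;> simp [J, add_comm]

theorem J_smul (c : ℂ) (x : Fin 4 → ℂ) : J (c • x) = starRingEnd ℂ c • J x := by
  ext i
  fin_cases i <;> simp [J]

theorem J_J (x : Fin 4 → ℂ) : J (J x) = -x := by
  ext i
  fin_cases i <;> simp [J]

theorem mul_conj_add_mul_conj_eq_zero {a b : ℂ}
    (h : a * starRingEnd ℂ a + b * starRingEnd ℂ b = 0) : a = 0 ∧ b = 0 := by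
  rw [Complex.mul_conj, Complex.mul_conj, ← Complex.ofReal_add, Complex.ofReal_eq_zero] at h
  have ha := Complex.normSq_nonneg a
  have hb := Complex.normSq_nonneg b
  exact ⟨Complex.normSq_eq_zero.1 (by linarith), Complex.normSq_eq_zero.1 (by linarith)⟩

theorem eq_zero_of_smul_add_smul_J {x : Fin 4 → ℂ} (hx : x ≠ 0) {a b : ℂ}
    (h : a • x + b • J x = 0) : a = 0 ∧ b = 0 := by
  have hJ : starRingEnd ℂ a • J x - starRingEnd ℂ b • x = 0 := by
    have := congrArg J h
    rw [J_add, J_smul, J_smul, J_J] at this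
    rw [sub_eq_add_neg, ← smul_neg, this]
    ext i
    fin_cases i <;> simp [J]
  have h0 : (a * starRingEnd ℂ a + b * starRingEnd ℂ b) • x = 0 := by
    calc _ = starRingEnd ℂ a • (a • x + b • J x)
          - b • (starRingEnd ℂ a • J x - starRingEnd ℂ b • x) := by module
      _ = 0 := by rw [h, hJ]; simp
  exact mul_conj_add_mul_conj_eq_zero ((smul_eq_zero.1 h0).resolve_right hx)

namespace IsTwistorLine

variable {W W' : Submodule ℂ (Fin 4 → ℂ)}

theorem J_mem (hW : IsTwistorLine W) {x : Fin 4 → ℂ} (hx : x ∈ W) : J x ∈ W := by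
  have : J x ∈ J '' (W : Set (Fin 4 → ℂ)) := Set.mem_image_of_mem _ hx
  rwa [hW.2] at this

theorem span_eq (hW : IsTwistorLine W) {x : Fin 4 → ℂ} (hx : x ∈ W) (hx0 : x ≠ 0) :
    Submodule.span ℂ {x, J x} = W := by
  have hli : LinearIndependent ℂ ![x, J x] :=
    LinearIndependent.pair_iff.2 fun a b h => eq_zero_of_smul_add_smul_J hx0 h
  apply Submodule.eq_of_le_of_finrank_eq
  · rw [Submodule.span_le, Set.insert_subset_iff, Set.singleton_subset_iff]
    exact ⟨hx, hW.J_mem hx⟩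
  · have := finrank_span_eq_card hli
    rw [Matrix.range_cons, Matrix.range_cons, Matrix.range_empty, Set.union_empty,
      Set.singleton_union, Fintype.card_fin] at this
    rw [this, hW.1]

theorem exists_eq (hW : IsTwistorLine W) {x w : Fin 4 → ℂ} (hx : x ∈ W) (hx0 : x ≠ 0)
    (hw : w ∈ W) : ∃ a b : ℂ, w = a • x + b • J x := by
  rw [← hW.span_eq hx hx0, Submodule.mem_span_pair] at hw
  obtain ⟨a, b, h⟩ := hw
  exact ⟨a, b, h.symm⟩

theorem eq_of_mem (hW : IsTwistorLine W) (hW' : IsTwistorLine W') {x : Fin 4 → ℂ}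
    (hx : x ∈ W) (hx' : x ∈ W') (hx0 : x ≠ 0) : W = W' := by
  rw [← hW.span_eq hx hx0, hW'.span_eq hx' hx0]

theorem exists_add_eq (hW : IsTwistorLine W) (hW' : IsTwistorLine W') (hne : W ≠ W')
    (v : Fin 4 → ℂ) : ∃ w ∈ W, ∃ w' ∈ W', w + w' = v := by
  rw [← Submodule.mem_sup, Submodule.eq_top_of_disjoint W W']
  · trivial
  · rw [hW.1, hW'.1]; simp
  · rw [Submodule.disjoint_def]
    intro x hx hx'
    by_contra hx0
    exact hne (hW.eq_of_mem hW' hx hx' hx0)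

end IsTwistorLine

theorem IsTwistorLine.apply_eq_zero {V : Submodule ℂ (Fin 4 → ℂ)} (hV : IsTwistorLine V)
    {T : (Fin 4 → ℂ) →ₗ[ℂ] (Fin 4 → ℂ) →ₗ[ℂ] (Fin 4 → ℂ) →ₗ[ℂ] ℂ} (hT : IsSmoothForm T)
    {P Q : Fin 4 → ℂ} (hvan : ∀ z ∈ V, T z z z = 0) {m : ℂ} (hm : P + m • Q ∈ V) :
    T (P + m • Q) (P + m • Q) ((1 : ℂ) • J P + starRingEnd ℂ m • J Q) = 0 ∧
    T (P + m • Q) ((1 : ℂ) • J P + starRingEnd ℂ m • J Q)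
      ((1 : ℂ) • J P + starRingEnd ℂ m • J Q) = 0 := by
  have hJ := hV.J_mem hm
  have h1 := hT.polar_eq_zero hvan hm hJ
  have h2 := hT.polar_eq_zero hvan hJ hm
  rw [hT.symm_right, hT.symm_left] at h2
  rw [J_add, J_smul] at h1 h2
  rw [one_smul]
  exact ⟨h1, h2⟩

/-- Four twistor lines on a smooth cubic, and two points `P`, `Q` spanning a line which meets all
of them. -/
structure IsTwistorTransversal
    (T : (Fin 4 → ℂ) →ₗ[ℂ] (Fin 4 → ℂ) →ₗ[ℂ] (Fin 4 → ℂ) →ₗ[ℂ] ℂ)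
    (W : Fin 4 → Submodule ℂ (Fin 4 → ℂ)) (P Q : Fin 4 → ℂ) (l : ℂ) : Prop where
  smooth : IsSmoothForm T
  twistor : ∀ i, IsTwistorLine (W i)
  inj : Function.Injective W
  vanish : ∀ i, ∀ z ∈ W i, T z z z = 0
  left_ne_zero : P ≠ 0
  right_ne_zero : Q ≠ 0
  mem_zero : P ∈ W 0
  mem_one : Q ∈ W 1
  mem_two : P + Q ∈ W 2
  mem_three : P + l • Q ∈ W 3

theorem exists_isTwistorTransversal
    {T : (Fin 4 → ℂ) →ₗ[ℂ] (Fin 4 → ℂ) →ₗ[ℂ] (Fin 4 → ℂ) →ₗ[ℂ] ℂ} (hT : IsSmoothForm T)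
    {W : Fin 4 → Submodule ℂ (Fin 4 → ℂ)} (hW : ∀ i, IsTwistorLine (W i))
    (hinj : Function.Injective W) (hvan : ∀ i, ∀ z ∈ W i, T z z z = 0) :
    ∃ P Q l, IsTwistorTransversal T W P Q l := by
  obtain ⟨x, hx, hx0⟩ : ∃ x ∈ W 0, x ≠ 0 := by
    apply Submodule.exists_mem_ne_zero_of_ne_bot
    intro h0
    have := (hW 0).1
    rw [IsLine, h0, finrank_bot] at this
    omega
  have hgraph (i : Fin 4) (hi : i ≠ 0) (hi1 : i ≠ 1) : ∃ u ∈ W 1, u ≠ 0 ∧ x + u ∈ W i := by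
    obtain ⟨w, hw, u, hu, h⟩ := (hW i).exists_add_eq (hW 1) (hinj.ne hi1) x
    refine ⟨-u, neg_mem hu, ?_, by rw [← h]; simpa using hw⟩
    intro hu0
    rw [neg_eq_zero] at hu0
    rw [hu0, add_zero] at h
    exact hi (hinj ((hW i).eq_of_mem (hW 0) (h ▸ hw) hx hx0))
  obtain ⟨u, hu, hu0, hxu⟩ := hgraph 2 (by decide) (by decide)
  obtain ⟨v, hv, -, hxv⟩ := hgraph 3 (by decide) (by decide)
  obtain ⟨m, n, rfl⟩ := (hW 1).exists_eq hu hu0 hv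
  have hJu := (hW 2).J_mem hxu
  have hJv := (hW 3).J_mem hxv
  simp only [J_add, J_smul, J_J] at hJu hJv
  obtain ⟨a, b, l, hab, h1, h2⟩ : ∃ a b l : ℂ, ¬ (a = 0 ∧ b = 0) ∧
      a * m - b * starRingEnd ℂ n = l * a ∧ a * n + b * starRingEnd ℂ m = l * b := by
    by_cases hn : n = 0
    · exact ⟨1, 0, m, by simp, by simp, by simp [hn]⟩
    · obtain ⟨l, hl⟩ := exists_root_quadratic (one_ne_zero (α := ℂ)) (-(m + starRingEnd ℂ m))
        (m * starRingEnd ℂ m + n * starRingEnd ℂ n)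
      exact ⟨l - starRingEnd ℂ m, n, l, by simp [hn], by linear_combination -hl, by ring⟩
  refine ⟨a • x + b • J x, a • u + b • J u, l, hT, hW, hinj, hvan,
    fun h0 => hab (eq_zero_of_smul_add_smul_J hx0 h0),
    fun h0 => hab (eq_zero_of_smul_add_smul_J hu0 h0),
    add_mem (Submodule.smul_mem _ _ hx) (Submodule.smul_mem _ _ ((hW 0).J_mem hx)),
    add_mem (Submodule.smul_mem _ _ hu) (Submodule.smul_mem _ _ ((hW 1).J_mem hu)), ?_, ?_⟩
  · convert add_mem (Submodule.smul_mem _ a hxu) (Submodule.smul_mem _ b hJu) using 1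
    module
  · convert add_mem (Submodule.smul_mem _ a hxv) (Submodule.smul_mem _ b hJv) using 1
    rw [smul_add l, smul_smul, smul_smul, ← h1, ← h2]
    module

namespace IsTwistorTransversal

variable {T : (Fin 4 → ℂ) →ₗ[ℂ] (Fin 4 → ℂ) →ₗ[ℂ] (Fin 4 → ℂ) →ₗ[ℂ] ℂ}
  {W : Fin 4 → Submodule ℂ (Fin 4 → ℂ)} {P Q : Fin 4 → ℂ} {l : ℂ}
  (h : IsTwistorTransversal T W P Q l)

include h

theorem indep (a b c d : ℂ) (h0 : a • P + b • Q + c • J P + d • J Q = 0) :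
    a = 0 ∧ b = 0 ∧ c = 0 ∧ d = 0 := by
  have hP : a • P + c • J P ∈ W 0 := add_mem (Submodule.smul_mem _ _ h.mem_zero)
    (Submodule.smul_mem _ _ ((h.twistor 0).J_mem h.mem_zero))
  have hQ : b • Q + d • J Q ∈ W 1 := add_mem (Submodule.smul_mem _ _ h.mem_one)
    (Submodule.smul_mem _ _ ((h.twistor 1).J_mem h.mem_one))
  have heq : a • P + c • J P = -(b • Q + d • J Q) := by
    rw [eq_neg_iff_add_eq_zero, ← h0]; abel
  have hP0 : a • P + c • J P = 0 := by
    by_contra hne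
    have := h.inj ((h.twistor 0).eq_of_mem (h.twistor 1) hP (heq ▸ neg_mem hQ) hne)
    exact absurd this (by decide)
  have hQ0 : b • Q + d • J Q = 0 := by rw [← neg_eq_zero, ← heq, hP0]
  obtain ⟨h1, h2⟩ := eq_zero_of_smul_add_smul_J h.left_ne_zero hP0
  obtain ⟨h3, h4⟩ := eq_zero_of_smul_add_smul_J h.right_ne_zero hQ0
  exact ⟨h1, h3, h2, h4⟩

theorem add_smul_ne_zero (m : ℂ) : P + m • Q ≠ 0 := fun h0 =>
  one_ne_zero (h.indep 1 m 0 0 (by simpa using h0)).1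

theorem ne_zero : l ≠ 0 := by
  rintro rfl
  have := h.mem_three
  rw [zero_smul, add_zero] at this
  exact absurd (h.inj ((h.twistor 0).eq_of_mem (h.twistor 3) h.mem_zero this h.left_ne_zero))
    (by decide)

theorem ne_one : l ≠ 1 := by
  rintro rfl
  have := h.mem_three
  rw [one_smul] at this
  refine absurd (h.inj ((h.twistor 2).eq_of_mem (h.twistor 3) h.mem_two this ?_)) (by decide)
  simpa using h.add_smul_ne_zero 1

theorem span_eq_top (v : Fin 4 → ℂ) :
    ∃ a b c d : ℂ, v = a • P + b • Q + c • J P + d • J Q := by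
  obtain ⟨w, hw, w', hw', rfl⟩ :=
    (h.twistor 0).exists_add_eq (h.twistor 1) (h.inj.ne (by decide)) v
  obtain ⟨a, c, rfl⟩ := (h.twistor 0).exists_eq h.mem_zero h.left_ne_zero hw
  obtain ⟨b, d, rfl⟩ := (h.twistor 1).exists_eq h.mem_one h.right_ne_zero hw'
  exact ⟨a, b, c, d, by abel⟩

theorem J_mem_two : J P + J Q ∈ W 2 := by
  simpa [J_add] using (h.twistor 2).J_mem h.mem_two

theorem J_mem_three : J P + starRingEnd ℂ l • J Q ∈ W 3 := by
  simpa [J_add, J_smul] using (h.twistor 3).J_mem h.mem_three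

theorem isSkewQuadrilateral : IsSkewQuadrilateral T P Q (J P) (J Q) := by
  have hJP := (h.twistor 0).J_mem h.mem_zero
  have hJQ := (h.twistor 1).J_mem h.mem_one
  have polar {x y : Fin 4 → ℂ} {k : ℂ} (hk : k ≠ 0) (hk1 : k ≠ 1) (hx : T x x x = 0)
      (hy : T y y y = 0) (h2 : T (x + y) (x + y) (x + y) = 0)
      (h3 : T (x + k • y) (x + k • y) (x + k • y) = 0) : T x x y = 0 ∧ T x y y = 0 := by
    rw [h.smooth.apply_self_add] at h2 h3
    simp only [map_smul, LinearMap.smul_apply, smul_eq_mul, hx, hy] at h2 h3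
    have h4 : T x y y = 0 := by
      apply mul_left_cancel₀ (mul_ne_zero hk (sub_ne_zero.2 hk1))
      linear_combination (h3 - k * h2) / 3
    exact ⟨by linear_combination h2 / 3 - h4, h4⟩
  have hk : starRingEnd ℂ l ≠ 0 := by simpa using h.ne_zero
  have hk1 : starRingEnd ℂ l ≠ 1 := by
    intro h0
    apply h.ne_one
    rw [← Complex.conj_conj l, h0, map_one]
  have hP := h.vanish 0 _ h.mem_zero
  have hQ := h.vanish 1 _ h.mem_one
  have hP' := h.vanish 0 _ hJP
  have hQ' := h.vanish 1 _ hJQ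
  obtain ⟨h1, h2⟩ := polar h.ne_zero h.ne_one hP hQ (h.vanish 2 _ h.mem_two)
    (h.vanish 3 _ h.mem_three)
  obtain ⟨h3, h4⟩ := polar hk hk1 hP' hQ' (h.vanish 2 _ h.J_mem_two) (h.vanish 3 _ h.J_mem_three)
  exact
  { toIsSmoothForm := h.smooth
    indep := h.indep
    span := fun φ k1 k2 k3 k4 => by
      refine LinearMap.ext fun v => ?_
      obtain ⟨a, b, c, d, rfl⟩ := h.span_eq_top v
      simp [k1, k2, k3, k4]
    PPP := hP
    PPQ := h1
    PQQ := h2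
    QQQ := hQ
    PPP' := hP'
    PPQ' := h3
    PQQ' := h4
    QQQ' := hQ'
    side_PPP := h.smooth.polar_eq_zero (h.vanish 0) h.mem_zero hJP
    side_QQQ := h.smooth.polar_eq_zero (h.vanish 1) h.mem_one hJQ
    side_PPP' := by
      rw [h.smooth.symm_left, h.smooth.symm_right]
      exact h.smooth.polar_eq_zero (h.vanish 0) hJP h.mem_zero
    side_QQQ' := by
      rw [h.smooth.symm_left, h.smooth.symm_right]
      exact h.smooth.polar_eq_zero (h.vanish 1) hJQ h.mem_one }

/-- A cubic with four lines meeting `PQ` and its image carries no two further common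
transversals of these two lines. -/
theorem not_two_transversals {σ t₁ t₂ : Fin 2 → ℂ} (hne : σ 0 ≠ σ 1) (h0 : ∀ i, σ i ≠ 0)
    (h1 : ∀ i, σ i ≠ 1) (hl : ∀ i, σ i ≠ l) (ht : ∀ i, ¬ (t₁ i = 0 ∧ t₂ i = 0))
    (hsst : ∀ i, T (P + σ i • Q) (P + σ i • Q) (t₁ i • J P + t₂ i • J Q) = 0)
    (hstt : ∀ i, T (P + σ i • Q) (t₁ i • J P + t₂ i • J Q) (t₁ i • J P + t₂ i • J Q) = 0) :
    False := by
  have k1 := (h.twistor 2).apply_eq_zero (m := 1) h.smooth (h.vanish 2) (by simpa using h.mem_two)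
  have k2 := (h.twistor 3).apply_eq_zero h.smooth (h.vanish 3) h.mem_three
  refine h.isSkewQuadrilateral.not_four_transversals (σ := ![1, l, σ 0, σ 1])
    (t₁ := ![1, 1, t₁ 0, t₁ 1]) (t₂ := ![starRingEnd ℂ 1, starRingEnd ℂ l, t₂ 0, t₂ 1])
    ?_ ?_ ?_ ?_ ?_
  · intro i j hij
    have h1' (i) := (h1 i).symm
    have hl' (i) := (hl i).symm
    fin_cases i <;> fin_cases j <;> simp_all [h.ne_one, h.ne_one.symm, hne.symm]
  · intro i
    fin_cases i
    exacts [one_ne_zero, h.ne_zero, h0 0, h0 1]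
  · intro i
    fin_cases i
    exacts [by simp, by simp, ht 0, ht 1]
  · intro i
    fin_cases i
    exacts [k1.1, k2.1, hsst 0, hsst 1]
  · intro i
    fin_cases i
    exacts [k1.2, k2.2, hstt 0, hstt 1]

/-- If `T s s t = 0` for a point `s` of `PQ` and a point `t` of `J P, J Q`, and the line `st` meets
a twistor line different from `W i`, then `s` does not lie on `W i`. -/
theorem ne_of_mem {V : Submodule ℂ (Fin 4 → ℂ)} (hV : IsTwistorLine V) {i : Fin 4}
    (hne : V ≠ W i) {σ τ t₁ t₂ : ℂ} (hs : P + τ • Q ∈ W i)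
    (h0 : T (P + σ • Q) (P + σ • Q) (t₁ • J P + t₂ • J Q) = 0)
    (hvan : ∀ z ∈ W i, T z z z = 0)
    (hmem : (P + σ • Q) + (t₁ • J P + t₂ • J Q) ∈ V) : σ ≠ τ := by
  rintro rfl
  have hJ := (h.twistor i).J_mem hs
  have h1 := h.smooth.polar_eq_zero hvan hs hJ
  rw [J_add, J_smul] at hJ h1
  have h2 := h.isSkewQuadrilateral.tangent_unique (s₁ := 1) (s₂ := σ) (t₁ := t₁) (t₂ := t₂)
    (r₁ := 1) (r₂ := starRingEnd ℂ σ) (by simp) (by simpa using h0) (by simpa using h1)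
  refine hne (hV.eq_of_mem (h.twistor i) hmem ?_ fun h3 => ?_)
  · convert add_mem hs (Submodule.smul_mem _ t₁ hJ) using 1
    rw [smul_add, smul_smul, h2, mul_one]
  · exact one_ne_zero (h.indep 1 σ t₁ t₂ (by rw [← h3]; module)).1

/-- A fifth twistor line on the cubic also meets `PQ`. -/
theorem exists_mem {V : Submodule ℂ (Fin 4 → ℂ)} (hV : IsTwistorLine V)
    (hvan : ∀ z ∈ V, T z z z = 0) (hne : ∀ i, V ≠ W i) : ∃ m : ℂ, P + m • Q ∈ V := by
  obtain ⟨w, hw, w', hw', hP⟩ := hV.exists_add_eq (h.twistor 1) (hne 1) P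
  obtain ⟨m, n, hmn⟩ := (h.twistor 1).exists_eq h.mem_one h.right_ne_zero (neg_mem hw')
  have hw5 : P + m • Q + n • J Q ∈ V := by
    rw [add_assoc, ← hmn, ← hP]; simpa using hw
  by_cases hn : n = 0
  · exact ⟨m, by simpa [hn] using hw5⟩
  exfalso
  have hn' : starRingEnd ℂ n ≠ 0 := by simpa using hn
  have hq := h.isSkewQuadrilateral
  have hw5' : -(starRingEnd ℂ n) • Q + (J P + starRingEnd ℂ m • J Q) ∈ V := by
    have := hV.J_mem hw5
    rw [J_add, J_add, J_smul, J_smul, J_J] at this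
    convert this using 1
    module
  obtain ⟨y, hy, hyt⟩ := hq.exists_two_transversals hn hn' hvan hw5 hw5'
  set σ : Fin 2 → ℂ := fun i => m - starRingEnd ℂ n * y i with hσ
  set τ : Fin 2 → ℂ := fun i => n + starRingEnd ℂ m * y i with hτ
  have hmem (i : Fin 2) : (P + σ i • Q) + (y i • J P + τ i • J Q) ∈ V := by
    convert add_mem hw5 (Submodule.smul_mem _ (y i) hw5') using 1
    simp only [hσ, hτ]
    module
  have hτ0 (i : Fin 2) : ¬ (y i = 0 ∧ τ i = 0) := by
    rintro ⟨h1, h2⟩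
    simp [hτ, h1, hn] at h2
  have hσ01 : σ 0 ≠ σ 1 := by
    simp only [hσ, ne_eq, sub_right_inj]
    exact fun h0 => hy (mul_left_cancel₀ hn' h0)
  have hne0 (i) : σ i ≠ 0 := h.ne_of_mem hV (hne 0) (by simpa using h.mem_zero) (hyt i).1
    (h.vanish 0) (hmem i)
  have hne1 (i) : σ i ≠ 1 := h.ne_of_mem hV (hne 2) (by simpa using h.mem_two) (hyt i).1
    (h.vanish 2) (hmem i)
  have hnel (i) : σ i ≠ l := h.ne_of_mem hV (hne 3) h.mem_three (hyt i).1
    (h.vanish 3) (hmem i)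
  exact h.not_two_transversals hσ01 hne0 hne1 hnel hτ0 (fun i => (hyt i).1) (fun i => (hyt i).2)

end IsTwistorTransversal

/-- A nonsingular cubic surface in `ℙ³(ℂ)` contains at most five twistor lines. -/
theorem at_most_five_twistor_lines (f : MvPolynomial (Fin 4) ℂ) (hf0 : f ≠ 0)
    (hhom : f.IsHomogeneous 3) (hns : Nonsingular f) :
    {W : Submodule ℂ (Fin 4 → ℂ) | IsTwistorLine W ∧ VanishesOn f W}.encard ≤ 5 := by
  by_contra! hlt
  obtain ⟨t, ht, hcard⟩ := Set.exists_subset_encard_eq (Order.add_one_le_of_lt hlt)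
  have hfin : t.Finite := Set.finite_of_encard_eq_coe (k := 6) (by rw [hcard]; norm_num)
  have : hfin.toFinset.card = 6 := by
    rw [hfin.encard_eq_coe_toFinset_card] at hcard
    exact_mod_cast hcard
  let e := (Finset.equivFinOfCardEq this).symm
  let W : Fin 6 → Submodule ℂ (Fin 4 → ℂ) := fun i => (e i : Submodule ℂ (Fin 4 → ℂ))
  have hinj : Function.Injective W := Subtype.val_injective.comp e.injective
  have hW (i) : IsTwistorLine (W i) ∧ VanishesOn f (W i) :=
    ht (hfin.mem_toFinset.1 (e i).2)
  have hT := isSmoothForm_cubicPolar hhom hns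
  have hvan (i) : ∀ z ∈ W i, cubicPolar f z z z = 0 := fun z hz => by
    rw [cubicPolar_self hhom]; exact (hW i).2 z hz
  let ι : Fin 4 → Fin 6 := Fin.castLE (by norm_num)
  have hι : Function.Injective ι := Fin.castLE_injective _
  obtain ⟨P, Q, l, h⟩ := exists_isTwistorTransversal hT (W := W ∘ ι) (fun i => (hW _).1)
    (hinj.comp hι) (fun i => hvan _)
  let κ : Fin 2 → Fin 6 := Fin.natAdd 4
  have hκι (i j) : W (κ i) ≠ W (ι j) := hinj.ne fun h0 => by
    have := congrArg Fin.val h0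
    simp [κ, ι] at this
    omega
  choose m hm using fun i => h.exists_mem (hW (κ i)).1 (hvan _) (hκι i)
  have hm_ne (i : Fin 2) {j : Fin 4} {τ : ℂ} (hτ : P + τ • Q ∈ W (ι j)) : m i ≠ τ := by
    rintro rfl
    exact hκι i j ((hW _).1.eq_of_mem (hW _).1 (hm i) hτ (h.add_smul_ne_zero _))
  have htr (i) := (hW _).1.apply_eq_zero hT (hvan _) (hm i)
  refine h.not_two_transversals (σ := m) (t₁ := 1) (t₂ := fun i => starRingEnd ℂ (m i)) ?_
    (fun i => hm_ne i (j := 0) (by simpa using h.mem_zero))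
    (fun i => hm_ne i (j := 2) (by simpa using h.mem_two))
    (fun i => hm_ne i (j := 3) h.mem_three) (by simp) (fun i => (htr i).1) (fun i => (htr i).2)
  intro h0
  have := hinj ((hW _).1.eq_of_mem (hW _).1 (hm 0) (h0 ▸ hm 1) (h.add_smul_ne_zero _))
  exact absurd this (by decide)
end
end

section
/- Five collinear lines in ℙ³(ℂ) lie on a (possibly singular) cubic surface: if W₁,…,W₅ are 2-dimensional ℂ-subspaces of ℂ⁴ and K is a further 2-dimensional ℂ-subspace with K ∩ Wᵢ ≠ {0} for every i = 1,…,5, then there exists a nonzero homogeneous polynomial f of degree 3 in z₁,z₂,z₃,z₄ vanishing identically on W₁ ∪ ⋯ ∪ W₅. -/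
noncomputable section

open MvPolynomial

theorem finrank_homogeneousSubmodule (σ R : Type*) [Fintype σ] [CommRing R] [Nontrivial R]
    (n : ℕ) :
    Module.finrank R (homogeneousSubmodule σ R n) = (Fintype.card σ).multichoose n := by
  classical
  have e : {d : σ →₀ ℕ | d.degree = n} ≃ Sym σ n :=
    (Equiv.subtypeEquivRight fun d => by
      simp [Finsupp.degree_eq_sum, Finsupp.sum_fintype]).trans (Sym.equivNatSum σ n).symm
  rw [show homogeneousSubmodule σ R n = restrictSupport R {d : σ →₀ ℕ | d.degree = n} from
      homogeneousSubmodule_eq_finsupp_supported σ R n,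
    Module.finrank_eq_nat_card_basis (basisRestrictSupport R {d : σ →₀ ℕ | d.degree = n}),
    Nat.card_congr e, Nat.card_eq_fintype_card, Sym.card_sym_eq_multichoose]

theorem exists_isHomogeneous_eval_eq_zero {σ k ι : Type*} [Fintype σ] [Field k] [Fintype ι]
    {n : ℕ} (h : Fintype.card ι < (Fintype.card σ).multichoose n) (x : ι → σ → k) :
    ∃ f : MvPolynomial σ k, f ≠ 0 ∧ f.IsHomogeneous n ∧ ∀ i, eval (x i) f = 0 := by
  have : Module.Finite k (homogeneousSubmodule σ k n) :=
    Module.finite_of_finrank_pos (by rw [finrank_homogeneousSubmodule]; omega)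
  let φ : homogeneousSubmodule σ k n →ₗ[k] ι → k :=
    LinearMap.pi fun i => (aeval (x i)).toLinearMap ∘ₗ (homogeneousSubmodule σ k n).subtype
  have hφ : LinearMap.ker φ ≠ ⊥ := φ.ker_ne_bot_of_finrank_lt <| by
    rwa [Module.finrank_fintype_fun_eq_card, finrank_homogeneousSubmodule]
  obtain ⟨f, hf, hf0⟩ := (Submodule.ne_bot_iff _).1 hφ
  refine ⟨f, by simpa using hf0, f.2, fun i => ?_⟩
  simpa [φ, aeval_eq_eval] using congrFun (LinearMap.mem_ker.1 hf) i

theorem eval_add_smul_eq_zero {σ R ι : Type*} [CommRing R] [IsDomain R] [Fintype ι]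
    {n : ℕ} {f : MvPolynomial σ R} (hf : f.totalDegree ≤ n) {c : ι → R}
    (hc : Function.Injective c) (hn : n < Fintype.card ι) {p q : σ → R}
    (h : ∀ i, eval (p + c i • q) f = 0) (t : R) : eval (p + t • q) f = 0 := by
  let P : Polynomial R := aeval (fun j => Polynomial.C (p j) + Polynomial.X * Polynomial.C (q j)) f
  have hP : ∀ t, P.eval t = eval (p + t • q) f := fun t => by
    rw [← Polynomial.coe_evalRingHom, ← aeval_eq_eval]
    simp only [P, aeval_def, hom_eval₂]
    congr 1
    · ext; simp
    · ext j; simpa using mul_comm (q j) t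
  have hdeg : P.natDegree ≤ n * 1 := aeval_natDegree_le _ hf _ fun j => by compute_degree
  rw [← hP, Polynomial.eq_zero_of_natDegree_lt_card_of_eval_eq_zero P hc
    (fun i => by rw [hP, h]) (by omega), Polynomial.eval_zero]

theorem MvPolynomial.IsHomogeneous.eval_smul {σ R : Type*} [CommSemiring R] {n : ℕ}
    {f : MvPolynomial σ R} (hf : f.IsHomogeneous n) (s : R) (x : σ → R) :
    eval (s • x) f = s ^ n * eval x f := by
  simp only [eval_eq, Pi.smul_apply, smul_eq_mul, mul_pow, Finset.prod_mul_distrib, Finset.mul_sum]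
  refine Finset.sum_congr rfl fun d hd => ?_
  rw [Finset.prod_pow_eq_pow_sum, ← hf.degree_eq_sum_deg_support hd, mul_left_comm]

theorem MvPolynomial.IsHomogeneous.eval_smul_add_smul_eq_zero {σ k : Type*} [Field k] [CharZero k]
    {n : ℕ} {f : MvPolynomial σ k} (hf : f.IsHomogeneous n) {p q : σ → k}
    (h : ∀ i : Fin (n + 1), eval (p + (i : k) • q) f = 0) (s t : k) :
    eval (s • p + t • q) f = 0 := by
  have hline := eval_add_smul_eq_zero hf.totalDegree_le
    (c := fun i : Fin (n + 1) => ((i : ℕ) : k))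
    (Nat.cast_injective.comp Fin.val_injective) (by simp) h
  have hne : ∀ s t : k, s ≠ 0 → eval (s • p + t • q) f = 0 := fun s t hs => by
    have : s • p + t • q = s • (p + (s⁻¹ * t) • q) := by
      rw [smul_add, smul_smul, mul_inv_cancel_left₀ hs]
    rw [this, hf.eval_smul, hline, mul_zero]
  have hswap := eval_add_smul_eq_zero hf.totalDegree_le (p := t • q) (q := p)
    (c := fun i : Fin (n + 1) => (((i : ℕ) + 1 : ℕ) : k))
    (Nat.cast_injective.comp ((add_left_injective 1).comp Fin.val_injective)) (by simp)
    (fun i => by rw [add_comm]; exact hne _ _ (Nat.cast_ne_zero.2 i.val.succ_ne_zero)) s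
  rwa [add_comm]

theorem Submodule.exists_forall_mem_eq_smul_add_smul {k V : Type*} [Field k] [AddCommGroup V]
    [Module k V] {W : Submodule k V} (hW : Module.finrank k W = 2) {p : V} (hp : p ∈ W)
    (hp0 : p ≠ 0) : ∃ q ∈ W, ∀ z ∈ W, ∃ s t : k, s • p + t • q = z := by
  obtain ⟨q, hq⟩ := exists_linearIndependent_pair_of_one_lt_finrank (R := k) (M := W)
    (by omega) (x := ⟨p, hp⟩) (by simpa using hp0)
  refine ⟨q, q.2, fun z hz => ?_⟩
  have hspan := hq.span_eq_top_of_card_eq_finrank (by simp [hW])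
  have hmem : (⟨z, hz⟩ : W) ∈ Submodule.span k (Set.range ![⟨p, hp⟩, q]) := hspan ▸ mem_top
  rw [Matrix.range_cons_cons_empty, mem_span_pair] at hmem
  obtain ⟨s, t, hst⟩ := hmem
  exact ⟨s, t, congrArg Subtype.val hst⟩

/-- Five collinear lines in `ℙ³(ℂ)` (five lines all meeting a further line `K`)
lie on a (possibly singular) cubic surface. -/
theorem five_collinear_lines_on_a_cubic (W : Fin 5 → Submodule ℂ (Fin 4 → ℂ))
    (hW : ∀ i, IsLine (W i))
    (K : Submodule ℂ (Fin 4 → ℂ)) (hK : IsLine K)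
    (hmeet : ∀ i, K ⊓ W i ≠ ⊥) :
    ∃ f : MvPolynomial (Fin 4) ℂ, f ≠ 0 ∧ f.IsHomogeneous 3 ∧
      ∀ i, VanishesOn f (W i) := by
  have hpt : ∀ i, ∃ p ∈ K ⊓ W i, p ≠ 0 := fun i => (Submodule.ne_bot_iff _).1 (hmeet i)
  choose p hp hp0 using hpt
  choose q _ hq using fun i =>
    Submodule.exists_forall_mem_eq_smul_add_smul (hW i) (hp i).2 (hp0 i)
  obtain ⟨r, _, hr⟩ := Submodule.exists_forall_mem_eq_smul_add_smul hK (hp 0).1 (hp0 0)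
  obtain ⟨f, hf0, hf, hzero⟩ := exists_isHomogeneous_eval_eq_zero (n := 3)
    (show Fintype.card (Fin 4 ⊕ Fin 5 × Fin 3) < (Fintype.card (Fin 4)).multichoose 3 by
      simp [Nat.multichoose_eq, Nat.choose])
    (Sum.elim (fun j => p 0 + ((j : ℕ) : ℂ) • r)
      fun ij => p ij.1 + ((ij.2.succ : ℕ) : ℂ) • q ij.1)
  refine ⟨f, hf0, hf, fun i z hz => ?_⟩
  have hfK : VanishesOn f K := fun z hz => by
    obtain ⟨s, t, rfl⟩ := hr z hz
    exact hf.eval_smul_add_smul_eq_zero (fun j => hzero (.inl j)) s t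
  obtain ⟨s, t, rfl⟩ := hq i z hz
  refine hf.eval_smul_add_smul_eq_zero (Fin.cases ?_ fun j => hzero (.inr (i, j))) s t
  simpa using hfK _ (hp i).1
end
end

section
/- The cubic surface { z₁z₄² + z₂z₃² − z₃z₂² − z₄z₁² = 0 } is projectively equivalent to the Fermat cubic { z₁³ + z₂³ + z₃³ + z₄³ = 0 }: there exists a ℂ-linear automorphism g of ℂ⁴ and a nonzero constant c such that (z₁³ + z₂³ + z₃³ + z₄³) ∘ g = c · (z₁z₄² + z₂z₃² − z₃z₂² − z₄z₁²) as polynomials. -/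
noncomputable section

open MvPolynomial

/-- For a root `ω` of `1 + ω + ω²`, the linear automorphism sending each pair `(x, w)` among
`(z₁, z₄)` and `(z₂, z₃)` to `(w + ωx, -(w + ω²x))`. -/
def cubicEquivFermat (ω : ℂ) (hω : 1 + ω + ω ^ 2 = 0) : (Fin 4 → ℂ) ≃ₗ[ℂ] (Fin 4 → ℂ) where
  toFun z := ![z 3 + ω * z 0, -(z 3 + ω ^ 2 * z 0), z 2 + ω * z 1, -(z 2 + ω ^ 2 * z 1)]
  invFun u := ![-(2 * ω + 1) / 3 * (u 0 + u 1), -(2 * ω + 1) / 3 * (u 2 + u 3),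
    u 2 + ω * (2 * ω + 1) / 3 * (u 2 + u 3), u 0 + ω * (2 * ω + 1) / 3 * (u 0 + u 1)]
  map_add' x y := by
    ext i
    fin_cases i <;> simp <;> ring
  map_smul' a x := by
    ext i
    fin_cases i <;> simp <;> ring
  left_inv z := by
    ext i
    fin_cases i <;> simp <;> grind
  right_inv u := by
    ext i
    fin_cases i <;> simp <;> grind

/-- The cubic surface `{z₁z₄² + z₂z₃² − z₃z₂² − z₄z₁² = 0}` is projectively equivalent
to the Fermat cubic `{z₁³ + z₂³ + z₃³ + z₄³ = 0}`. -/
theorem specialCubic_projectively_equivalent_Fermat :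
    ∃ (g : (Fin 4 → ℂ) ≃ₗ[ℂ] (Fin 4 → ℂ)) (c : ℂ), c ≠ 0 ∧
      ∀ z : Fin 4 → ℂ,
        eval (g z) (X 0 ^ 3 + X 1 ^ 3 + X 2 ^ 3 + X 3 ^ 3 : MvPolynomial (Fin 4) ℂ) =
          c * eval z (X 0 * X 3 ^ 2 + X 1 * X 2 ^ 2 - X 2 * X 1 ^ 2 - X 3 * X 0 ^ 2 :
            MvPolynomial (Fin 4) ℂ) := by
  obtain ⟨ω, hω⟩ : ∃ ω : ℂ, 1 + ω + ω ^ 2 = 0 := by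
    obtain ⟨s, hs⟩ := IsAlgClosed.exists_pow_nat_eq (-3 : ℂ) two_pos
    exact ⟨(s - 1) / 2, by linear_combination hs / 4⟩
  refine ⟨cubicEquivFermat ω hω, 3 * (ω - ω ^ 2), by grind, fun z => ?_⟩
  simp [cubicEquivFermat]
  grind
end
end
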